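/- arXiv:1007.0632 — 12 statements merged into one kernel-verified Lean document; each statement's English description precedes it below -/
import Mathlib

section
/- Let R be a ring and (D, E, u, v, ∂) an exact couple of R-modules. Set d := v ∘ ∂ : E → E. Then: (i) d ∘ d = 0, so B := range d is contained in Z := ker d; (ii) v maps ker u into B, and ∂ maps Z into D' := range u; (iii) consequently there are well-defined R-linear maps u' : D' → D', v' : D' → Z⧸B and ∂' : Z⧸B → D' determined by u'(x) = u(x) for x ∈ D', v'(u(x)) = [v(x)] for all x ∈ D, and ∂'([e]) = ∂(e) for e ∈ Z; and (iv) the derived couple (D', Z⧸B, u', v', ∂') is again exact, i.e. range u' = ker v', range v' = ker ∂', and range ∂' = ker u'. -/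
/-- For an exact couple `(D, E, u, v, w)` of `R`-modules (where `w` plays the
role of `∂`), with `d := v ∘ w : E → E`, `B := range d`, `Z := ker d`, `D' := range u`:
(i) `d ∘ d = 0` and `B ≤ Z`; (ii) `v` maps `ker u` into `B` and `w` maps `Z` into `D'`;
(iii)-(iv) there are `R`-linear maps `u' : D' → D'`, `v' : D' → Z⧸B`, `∂' : Z⧸B → D'`
determined by the stated equations, and the derived couple `(D', Z⧸B, u', v', ∂')` is exact. -/
theorem exact_couple_derived_couple_exact
    {R D E : Type*} [Ring R] [AddCommGroup D] [AddCommGroup E] [Module R D] [Module R E]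
    (u : D →ₗ[R] D) (v : D →ₗ[R] E) (w : E →ₗ[R] D)
    (h1 : LinearMap.range u = LinearMap.ker v)
    (h2 : LinearMap.range v = LinearMap.ker w)
    (h3 : LinearMap.range w = LinearMap.ker u) :
    -- (i)
    (v ∘ₗ w) ∘ₗ (v ∘ₗ w) = 0 ∧
    LinearMap.range (v ∘ₗ w) ≤ LinearMap.ker (v ∘ₗ w) ∧
    -- (ii)
    Submodule.map v (LinearMap.ker u) ≤ LinearMap.range (v ∘ₗ w) ∧
    Submodule.map w (LinearMap.ker (v ∘ₗ w)) ≤ LinearMap.range u ∧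
    -- (iii) and (iv)
    ∃ (u' : LinearMap.range u →ₗ[R] LinearMap.range u)
      (v' : LinearMap.range u →ₗ[R]
        (LinearMap.ker (v ∘ₗ w) ⧸
          (LinearMap.range (v ∘ₗ w)).comap (LinearMap.ker (v ∘ₗ w)).subtype))
      (del' : (LinearMap.ker (v ∘ₗ w) ⧸
          (LinearMap.range (v ∘ₗ w)).comap (LinearMap.ker (v ∘ₗ w)).subtype)
          →ₗ[R] LinearMap.range u),
      (∀ x : LinearMap.range u, (u' x : D) = u (x : D)) ∧
      (∀ (x : D) (hx : u x ∈ LinearMap.range u) (hv : v x ∈ LinearMap.ker (v ∘ₗ w)),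
        v' ⟨u x, hx⟩ = Submodule.Quotient.mk ⟨v x, hv⟩) ∧
      (∀ e : LinearMap.ker (v ∘ₗ w),
        (del' (Submodule.Quotient.mk e) : D) = w (e : E)) ∧
      LinearMap.range u' = LinearMap.ker v' ∧
      LinearMap.range v' = LinearMap.ker del' ∧
      LinearMap.range del' = LinearMap.ker u' := by
  have a1 : ∀ x, v (u x) = 0 := fun x => by
    have : u x ∈ LinearMap.ker v := h1 ▸ LinearMap.mem_range_self u x
    exact this
  have a2 : ∀ x, w (v x) = 0 := fun x => by
    have : v x ∈ LinearMap.ker w := h2 ▸ LinearMap.mem_range_self v x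
    exact this
  have a3 : ∀ x, u (w x) = 0 := fun x => by
    have : w x ∈ LinearMap.ker u := h3 ▸ LinearMap.mem_range_self w x
    exact this
  have b1 : ∀ x, v x = 0 → ∃ y, u y = x := fun x hx => by
    have : x ∈ LinearMap.range u := h1 ▸ LinearMap.mem_ker.2 hx
    exact this
  have b2 : ∀ x, w x = 0 → ∃ y, v y = x := fun x hx => by
    have : x ∈ LinearMap.range v := h2 ▸ LinearMap.mem_ker.2 hx
    exact this
  have b3 : ∀ x, u x = 0 → ∃ y, w y = x := fun x hx => by
    have : x ∈ LinearMap.range w := h3 ▸ LinearMap.mem_ker.2 hx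
    exact this
  have hvZ : ∀ x, v x ∈ LinearMap.ker (v ∘ₗ w) := fun x => by simp [a2]
  have hwD : ∀ e : LinearMap.ker (v ∘ₗ w), w (e : E) ∈ LinearMap.range u := fun e =>
    b1 _ e.2
  refine ⟨?_, ?_, ?_, ?_, ?_⟩
  · ext x; simp [a2]
  · rintro _ ⟨x, rfl⟩; simp [a2]
  · rintro _ ⟨x, hx, rfl⟩
    obtain ⟨y, rfl⟩ := b3 x hx
    exact ⟨y, rfl⟩
  · rintro _ ⟨x, hx, rfl⟩
    exact b1 _ hx
  let B' := (LinearMap.range (v ∘ₗ w)).comap (LinearMap.ker (v ∘ₗ w)).subtype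
  let v0 : D →ₗ[R] (LinearMap.ker (v ∘ₗ w) ⧸ B') := B'.mkQ ∘ₗ v.codRestrict _ hvZ
  have hv0 : LinearMap.ker u ≤ LinearMap.ker v0 := fun x hx => by
    obtain ⟨y, rfl⟩ := b3 x hx
    exact (Submodule.Quotient.mk_eq_zero B').2 ⟨y, rfl⟩
  let v' : LinearMap.range u →ₗ[R] (LinearMap.ker (v ∘ₗ w) ⧸ B') :=
    (LinearMap.ker u).liftQ v0 hv0 ∘ₗ u.quotKerEquivRange.symm.toLinearMap
  have ev : ∀ (x : D) (hx : u x ∈ LinearMap.range u) (hv : v x ∈ LinearMap.ker (v ∘ₗ w)),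
      v' ⟨u x, hx⟩ = Submodule.Quotient.mk ⟨v x, hv⟩ := fun x hx hv => by
    have : u.quotKerEquivRange.symm ⟨u x, hx⟩ = (LinearMap.ker u).mkQ x :=
      LinearMap.quotKerEquivRange_symm_apply_image u x hx
    change (LinearMap.ker u).liftQ v0 hv0 (u.quotKerEquivRange.symm ⟨u x, hx⟩) = _
    rw [this]
    rfl
  let del' : (LinearMap.ker (v ∘ₗ w) ⧸ B') →ₗ[R] LinearMap.range u :=
    B'.liftQ ((w ∘ₗ (LinearMap.ker (v ∘ₗ w)).subtype).codRestrict _ hwD) (by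
      rintro e ⟨y, hy⟩
      apply Subtype.ext
      change w (e : E) = 0
      have hy' : v (w y) = (e : E) := hy
      rw [← hy', a2])
  have ed : ∀ e : LinearMap.ker (v ∘ₗ w),
      (del' (Submodule.Quotient.mk e) : D) = w (e : E) := fun e => rfl
  let u' : LinearMap.range u →ₗ[R] LinearMap.range u :=
    (u ∘ₗ (LinearMap.range u).subtype).codRestrict _ (fun x => ⟨_, rfl⟩)
  have eu : ∀ x : LinearMap.range u, (u' x : D) = u (x : D) := fun x => rfl
  refine ⟨u', v', del', eu, ev, ed, ?_, ?_, ?_⟩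
  · apply le_antisymm
    · rintro _ ⟨⟨_, y, rfl⟩, rfl⟩
      refine (ev (u y) ⟨_, rfl⟩ (hvZ _)).trans ((Submodule.Quotient.mk_eq_zero B').2 ?_)
      exact ⟨0, by simp [a1]⟩
    · rintro ⟨_, x, rfl⟩ hx
      have h0 := (ev x ⟨_, rfl⟩ (hvZ _)).symm.trans hx
      obtain ⟨e, he⟩ := (Submodule.Quotient.mk_eq_zero B').1 h0
      have he' : v (w e) = v x := he
      obtain ⟨y, hy⟩ := b1 (x - w e) (by rw [map_sub, he', sub_self])
      refine ⟨⟨u y, y, rfl⟩, Subtype.ext ?_⟩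
      change u (u y) = u x
      rw [hy, map_sub, a3, sub_zero]
  · apply le_antisymm
    · rintro _ ⟨⟨_, y, rfl⟩, rfl⟩
      rw [LinearMap.mem_ker, ev y ⟨_, rfl⟩ (hvZ _)]
      exact Subtype.ext (a2 y)
    · intro q hq
      obtain ⟨e, rfl⟩ := Submodule.Quotient.mk_surjective B' q
      obtain ⟨x, hx⟩ := b2 (e : E) (congrArg Subtype.val hq)
      refine ⟨⟨u x, x, rfl⟩, (ev x ⟨_, rfl⟩ (hvZ _)).trans ?_⟩
      exact congrArg _ (Subtype.ext hx)
  · apply le_antisymm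
    · rintro _ ⟨q, rfl⟩
      obtain ⟨e, rfl⟩ := Submodule.Quotient.mk_surjective B' q
      exact Subtype.ext (a3 e)
    · rintro ⟨_, y, rfl⟩ hx
      obtain ⟨e, he⟩ := b3 (u y) (congrArg Subtype.val hx)
      refine ⟨Submodule.Quotient.mk ⟨e, ?_⟩, Subtype.ext he⟩
      change v (w e) = 0
      rw [he, a1]
end

section
/- Let R be a ring and (D, E, u, v, ∂) an exact couple of R-modules. For each integer r ≥ 1 set Z_r := ∂⁻¹(range u^{r−1}) and B_r := v(ker u^{r−1}), both submodules of E. Then: (i) B_r ⊆ Z_r, B_r ⊆ B_{r+1} and Z_{r+1} ⊆ Z_r; (ii) setting E_r := Z_r⧸B_r, there is a unique well-defined R-linear map d_r : E_r → E_r such that d_r([e]) = [v(x)] whenever e ∈ Z_r and x ∈ D satisfies u^{r−1}(x) = ∂(e); (iii) ker d_r = Z_{r+1}⧸B_r and range d_r = B_{r+1}⧸B_r; hence the homology ker d_r ⧸ range d_r is isomorphic to E_{r+1} = Z_{r+1}⧸B_{r+1}. -/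
/-- For an exact couple `(D, E, u, v, w)` of `R`-modules and `r ≥ 1`, with
`Z k := w⁻¹(range u^(k-1))` and `B k := v(ker u^(k-1))`:
(i) `B r ≤ Z r`, `B r ≤ B (r+1)`, `Z (r+1) ≤ Z r`;
(ii) there is a unique linear `d_r : Z r ⧸ B r → Z r ⧸ B r` with
`d_r [e] = [v x]` whenever `e ∈ Z r` and `u^(r-1) x = w e`;
(iii) `ker d_r = Z (r+1) ⧸ B r`, `range d_r = B (r+1) ⧸ B r`, and the homology
`ker d_r ⧸ range d_r` is linearly isomorphic to `Z (r+1) ⧸ B (r+1)`. -/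
theorem exact_couple_spectral_terms
    {R D E : Type*} [Ring R] [AddCommGroup D] [AddCommGroup E] [Module R D] [Module R E]
    (u : D →ₗ[R] D) (v : D →ₗ[R] E) (w : E →ₗ[R] D)
    (h1 : LinearMap.range u = LinearMap.ker v)
    (h2 : LinearMap.range v = LinearMap.ker w)
    (h3 : LinearMap.range w = LinearMap.ker u)
    (r : ℕ) (hr : 1 ≤ r)
    (Z B : ℕ → Submodule R E)
    (hZ : ∀ k, Z k = Submodule.comap w (LinearMap.range (u ^ (k - 1))))
    (hB : ∀ k, B k = Submodule.map v (LinearMap.ker (u ^ (k - 1)))) :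
    -- (i)
    B r ≤ Z r ∧ B r ≤ B (r + 1) ∧ Z (r + 1) ≤ Z r ∧
    -- (ii) existence and uniqueness of the differential
    (∃! dr : (Z r ⧸ (B r).comap (Z r).subtype) →ₗ[R] (Z r ⧸ (B r).comap (Z r).subtype),
      ∀ (e : E) (he : e ∈ Z r) (x : D), (u ^ (r - 1)) x = w e →
        ∀ hv : v x ∈ Z r,
          dr (Submodule.Quotient.mk ⟨e, he⟩) = Submodule.Quotient.mk ⟨v x, hv⟩) ∧
    -- (iii) kernel, image and homology of any such differential
    (∀ dr : (Z r ⧸ (B r).comap (Z r).subtype) →ₗ[R] (Z r ⧸ (B r).comap (Z r).subtype),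
      (∀ (e : E) (he : e ∈ Z r) (x : D), (u ^ (r - 1)) x = w e →
        ∀ hv : v x ∈ Z r,
          dr (Submodule.Quotient.mk ⟨e, he⟩) = Submodule.Quotient.mk ⟨v x, hv⟩) →
      LinearMap.ker dr
          = Submodule.map ((B r).comap (Z r).subtype).mkQ ((Z (r + 1)).comap (Z r).subtype) ∧
      LinearMap.range dr
          = Submodule.map ((B r).comap (Z r).subtype).mkQ ((B (r + 1)).comap (Z r).subtype) ∧
      Nonempty ((LinearMap.ker dr ⧸
            (LinearMap.range dr).comap (LinearMap.ker dr).subtype)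
          ≃ₗ[R] (Z (r + 1) ⧸ (B (r + 1)).comap (Z (r + 1)).subtype))) := by
  obtain ⟨n, rfl⟩ : ∃ n, r = n + 1 := ⟨r - 1, by omega⟩
  have mZ : ∀ k e, e ∈ Z (k + 1) ↔ ∃ x, (u ^ k) x = w e := by
    intro k e
    rw [hZ]; simp
  have mB : ∀ k e, e ∈ B (k + 1) ↔ ∃ x, (u ^ k) x = 0 ∧ v x = e := by
    intro k e
    rw [hB]; simp
  have vu : ∀ x, v (u x) = 0 := fun x => by
    have : u x ∈ LinearMap.ker v := h1 ▸ LinearMap.mem_range_self u x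
    simpa using this
  have wv : ∀ x, w (v x) = 0 := fun x => by
    have : v x ∈ LinearMap.ker w := h2 ▸ LinearMap.mem_range_self v x
    simpa using this
  have uw : ∀ x, u (w x) = 0 := fun x => by
    have : w x ∈ LinearMap.ker u := h3 ▸ LinearMap.mem_range_self w x
    simpa using this
  have ev : ∀ x, v x = 0 → ∃ y, u y = x := fun x hx => by
    have : x ∈ LinearMap.range u := h1 ▸ (LinearMap.mem_ker.2 hx)
    simpa using this
  have eu : ∀ x, u x = 0 → ∃ y, w y = x := fun x hx => by
    have : x ∈ LinearMap.range w := h3 ▸ (LinearMap.mem_ker.2 hx)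
    simpa using this
  have us : ∀ k x, (u ^ (k + 1)) x = u ((u ^ k) x) := fun k x => by
    rw [pow_succ']; rfl
  have us' : ∀ k x, (u ^ (k + 1)) x = (u ^ k) (u x) := fun k x => by
    rw [pow_succ]; rfl
  have vZ : ∀ k x, v x ∈ Z (k + 1) := fun k x => (mZ k _).2 ⟨0, by rw [wv, map_zero]⟩
  have BZ : ∀ k l, B (k + 1) ≤ Z (l + 1) := by
    intro k l e he
    obtain ⟨x, -, rfl⟩ := (mB k e).1 he
    exact vZ l x
  have BB : B (n + 1) ≤ B (n + 1 + 1) := by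
    intro e he
    obtain ⟨x, hx, rfl⟩ := (mB n e).1 he
    exact (mB (n + 1) _).2 ⟨x, by rw [us, hx, map_zero], rfl⟩
  have ZZ : Z (n + 1 + 1) ≤ Z (n + 1) := by
    intro e he
    obtain ⟨x, hx⟩ := (mZ (n + 1) e).1 he
    exact (mZ n _).2 ⟨u x, by rw [← us', hx]⟩
  have key : ∀ (x : D) (y : Z (n + 1)), (∃ x', v x' = y.1 ∧ (u ^ n) x = (u ^ n) x') →
      (Submodule.Quotient.mk ⟨v x, vZ n x⟩ : Z (n + 1) ⧸ (B (n + 1)).comap (Z (n + 1)).subtype)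
        = Submodule.Quotient.mk y := by
    rintro x ⟨y, hy⟩ ⟨x', h, hx⟩
    rw [Submodule.Quotient.eq]
    show v x - y ∈ B (n + 1)
    exact (mB n _).2 ⟨x - x', by rw [map_sub, hx, sub_self], by rw [map_sub, h]⟩
  refine ⟨BZ n n, BB, ZZ, ?_, ?_⟩
  · have hc : ∀ e : Z (n + 1), ∃ x, (u ^ n) x = w e.1 := fun e => (mZ n _).1 e.2
    choose c hc using hc
    let g : Z (n + 1) →ₗ[R] (Z (n + 1) ⧸ (B (n + 1)).comap (Z (n + 1)).subtype) :=
      { toFun := fun e => Submodule.Quotient.mk ⟨v (c e), vZ n _⟩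
        map_add' := fun a b => by
          rw [← Submodule.Quotient.mk_add]
          refine key _ _ ⟨c a + c b, by simp, ?_⟩
          rw [map_add, hc, hc, hc]; simp
        map_smul' := fun t a => by
          rw [RingHom.id_apply, ← Submodule.Quotient.mk_smul]
          refine key _ _ ⟨t • c a, by simp, ?_⟩
          rw [map_smul, hc, hc]; simp }
    have hg : ∀ (e : Z (n + 1)) (x : D), (u ^ n) x = w e.1 →
        g e = Submodule.Quotient.mk ⟨v x, vZ n x⟩ := fun e x hx =>
      key _ _ ⟨x, rfl, by rw [hc, hx]⟩
    have hk : (B (n + 1)).comap (Z (n + 1)).subtype ≤ LinearMap.ker g := by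
      rintro ⟨e, he⟩ h
      obtain ⟨x, -, rfl⟩ := (mB n e).1 h
      rw [LinearMap.mem_ker, hg _ 0 (by rw [map_zero, wv]), Submodule.Quotient.mk_eq_zero]
      show v 0 ∈ B (n + 1)
      rw [map_zero]; exact zero_mem _
    refine ⟨Submodule.liftQ _ g hk, ?_, ?_⟩
    · intro e he x hx hv
      exact hg ⟨e, he⟩ x hx
    · intro d hd
      apply LinearMap.ext
      intro q
      obtain ⟨⟨e, he⟩, rfl⟩ := Submodule.Quotient.mk_surjective _ q
      exact hd e he (c ⟨e, he⟩) (hc ⟨e, he⟩) (vZ n _)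
  · intro d hd
    have hd' : ∀ (e : E) (he : e ∈ Z (n + 1)) (x : D), (u ^ n) x = w e →
        d (Submodule.Quotient.mk ⟨e, he⟩) = Submodule.Quotient.mk ⟨v x, vZ n x⟩ :=
      fun e he x hx => hd e he x hx (vZ n x)
    have K : ∀ (e : E) (he : e ∈ Z (n + 1)),
        d (Submodule.Quotient.mk ⟨e, he⟩) = 0 ↔ e ∈ Z (n + 1 + 1) := by
      intro e he
      obtain ⟨x, hx⟩ := (mZ n e).1 he
      rw [hd' e he x hx, Submodule.Quotient.mk_eq_zero]
      show v x ∈ B (n + 1) ↔ _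
      constructor
      · intro h
        obtain ⟨y, hy, hyx⟩ := (mB n _).1 h
        obtain ⟨t, ht⟩ := ev (x - y) (by rw [map_sub, hyx, sub_self])
        exact (mZ (n + 1) e).2 ⟨t, by rw [us', ht, map_sub, hy, hx, sub_zero]⟩
      · intro h
        obtain ⟨t, ht⟩ := (mZ (n + 1) e).1 h
        refine (mB n _).2 ⟨x - u t, ?_, ?_⟩
        · rw [map_sub, ← us', ht, hx, sub_self]
        · rw [map_sub, vu, sub_zero]
    have I : ∀ (e : E) (he : e ∈ Z (n + 1)),
        Submodule.Quotient.mk ⟨e, he⟩ ∈ LinearMap.range d ↔ e ∈ B (n + 1 + 1) := by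
      intro e he
      constructor
      · rintro ⟨q, hq⟩
        obtain ⟨⟨a, ha⟩, rfl⟩ := Submodule.Quotient.mk_surjective _ q
        obtain ⟨x, hx⟩ := (mZ n a).1 ha
        rw [hd' a ha x hx, Submodule.Quotient.eq] at hq
        have h4 : v x - e ∈ B (n + 1) := hq
        have h5 : v x ∈ B (n + 1 + 1) := (mB (n + 1) _).2 ⟨x, by rw [us, hx, uw], rfl⟩
        have := sub_mem h5 (BB h4)
        simpa using this
      · intro h
        obtain ⟨x, hx, rfl⟩ := (mB (n + 1) e).1 h
        rw [us] at hx
        obtain ⟨a, ha⟩ := eu _ hx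
        exact ⟨Submodule.Quotient.mk ⟨a, (mZ n a).2 ⟨x, ha.symm⟩⟩, hd' a _ x ha.symm⟩
    refine ⟨?_, ?_, ?_⟩
    · ext q
      constructor
      · intro h
        obtain ⟨⟨e, he⟩, rfl⟩ := Submodule.Quotient.mk_surjective _ q
        exact ⟨⟨e, he⟩, (K e he).1 h, rfl⟩
      · rintro ⟨⟨e, he⟩, h, rfl⟩
        exact (K e he).2 h
    · ext q
      constructor
      · intro h
        obtain ⟨⟨e, he⟩, rfl⟩ := Submodule.Quotient.mk_surjective _ q
        exact ⟨⟨e, he⟩, (I e he).1 h, rfl⟩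
      · rintro ⟨⟨e, he⟩, h, rfl⟩
        exact (I e he).2 h
    · let f0 : Z (n + 1 + 1) →ₗ[R] LinearMap.ker d :=
        LinearMap.codRestrict (LinearMap.ker d)
          (((B (n + 1)).comap (Z (n + 1)).subtype).mkQ.comp (Submodule.inclusion ZZ))
          (fun e => (K e.1 (ZZ e.2)).2 e.2)
      let f := ((LinearMap.range d).comap (LinearMap.ker d).subtype).mkQ.comp f0
      have hs : Function.Surjective f := by
        intro q
        obtain ⟨⟨q, hq⟩, rfl⟩ := Submodule.Quotient.mk_surjective _ q
        obtain ⟨⟨e, he⟩, rfl⟩ := Submodule.Quotient.mk_surjective _ q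
        exact ⟨⟨e, (K e he).1 hq⟩, rfl⟩
      have hk : LinearMap.ker f = (B (n + 1 + 1)).comap (Z (n + 1 + 1)).subtype := by
        ext ⟨e, he⟩
        rw [LinearMap.mem_ker]
        refine (Submodule.Quotient.mk_eq_zero _).trans ?_
        exact I e (ZZ he)
      exact ⟨((Submodule.quotEquivOfEq _ _ hk.symm).trans
        (f.quotKerEquivOfSurjective hs)).symm⟩
end

section
/- Let (X,S) be an action, X₁ ⊆ X a pointed subset (0_X ∈ X₁) and S₁ ⊆ S a subset. The following are equivalent: (i) S₁ is a subgroup of S, X₁·s ⊆ X₁ for every s ∈ S₁, and every s ∈ S which links two points of X₁ belongs to S₁; (ii) whenever s ∈ S links two points of X₁ one has X₁·s ⊆ X₁, and moreover S₁ = {s ∈ S | X₁·s ⊆ X₁} = {s ∈ S | s links two points of X₁}; (iii) S₁ is a subgroup of S and for every x ∈ X₁ and s ∈ S one has: x·s ∈ X₁ ⟺ s ∈ S₁. -/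
/-- For an action `(X, S)` (right action of a group `S` on a pointed set `X`
with basepoint `x0`, not necessarily fixed), a pointed subset `X₁` and a subset `S₁ ⊆ S`,
the three characterisations of "normal subobject data" are equivalent. -/
theorem action_normal_subobject_characterisations
    {X S : Type*} [Group S] (x0 : X) (act : X → S → X)
    (hact_one : ∀ x, act x 1 = x)
    (hact_mul : ∀ x (s t : S), act (act x s) t = act x (s * t))
    (X₁ : Set X) (hX₁ : x0 ∈ X₁) (S₁ : Set S) :
    -- (i) ↔ (ii)
    ((((∃ H : Subgroup S, (H : Set S) = S₁) ∧
        (∀ s ∈ S₁, ∀ x ∈ X₁, act x s ∈ X₁) ∧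
        (∀ s : S, (∃ x ∈ X₁, ∃ x' ∈ X₁, act x s = x') → s ∈ S₁)) ↔
      ((∀ s : S, (∃ x ∈ X₁, ∃ x' ∈ X₁, act x s = x') → ∀ x ∈ X₁, act x s ∈ X₁) ∧
        S₁ = {s : S | ∀ x ∈ X₁, act x s ∈ X₁} ∧
        S₁ = {s : S | ∃ x ∈ X₁, ∃ x' ∈ X₁, act x s = x'})))
    ∧
    -- (i) ↔ (iii)
    ((((∃ H : Subgroup S, (H : Set S) = S₁) ∧
        (∀ s ∈ S₁, ∀ x ∈ X₁, act x s ∈ X₁) ∧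
        (∀ s : S, (∃ x ∈ X₁, ∃ x' ∈ X₁, act x s = x') → s ∈ S₁)) ↔
      ((∃ H : Subgroup S, (H : Set S) = S₁) ∧
        ∀ x ∈ X₁, ∀ s : S, (act x s ∈ X₁ ↔ s ∈ S₁)))) := by
  refine ⟨⟨?_, ?_⟩, ⟨?_, ?_⟩⟩
  · rintro ⟨_, h1, h2⟩
    refine ⟨fun s hs => h1 s (h2 s hs), ?_, ?_⟩
    · ext s
      exact ⟨fun hs => h1 s hs, fun hs => h2 s ⟨x0, hX₁, _, hs x0 hX₁, rfl⟩⟩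
    · ext s
      exact ⟨fun hs => ⟨x0, hX₁, _, h1 s hs x0 hX₁, rfl⟩, fun hs => h2 s hs⟩
  · rintro ⟨_, h2, h3⟩
    have m2 : ∀ s, s ∈ S₁ ↔ ∀ x ∈ X₁, act x s ∈ X₁ := fun s => by
      conv_lhs => rw [h2]
      rfl
    have m3 : ∀ s, s ∈ S₁ ↔ ∃ x ∈ X₁, ∃ x' ∈ X₁, act x s = x' := fun s => by
      conv_lhs => rw [h3]
      rfl
    refine ⟨⟨{ carrier := S₁, mul_mem' := ?_, one_mem' := ?_, inv_mem' := ?_ }, rfl⟩,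
      fun s hs => (m2 s).1 hs, fun s hs => (m3 s).2 hs⟩
    · intro a b ha hb
      refine (m2 _).2 fun x hx => ?_
      rw [← hact_mul]
      exact (m2 b).1 hb _ ((m2 a).1 ha x hx)
    · refine (m2 _).2 fun x hx => ?_
      rw [hact_one]
      exact hx
    · intro a ha
      refine (m3 _).2 ⟨act x0 a, (m2 a).1 ha x0 hX₁, x0, hX₁, ?_⟩
      rw [hact_mul, mul_inv_cancel, hact_one]
  · rintro ⟨hH, h1, h2⟩
    exact ⟨hH, fun x hx s => ⟨fun h => h2 s ⟨x, hx, _, h, rfl⟩, fun h => h1 s h x hx⟩⟩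
  · rintro ⟨hH, h⟩
    refine ⟨hH, fun s hs x hx => (h x hx s).2 hs, ?_⟩
    rintro s ⟨x, hx, x', hx', e⟩
    exact (h x hx s).1 (e ▸ hx')
end

section
/- Let (X,S) be an action and X₁ ⊆ X a normal subset with operator subgroup S₁ = {s ∈ S | X₁·s ⊆ X₁}. Define the relation R on X by: x R x' iff x = x', or there exist x₁, x₁' ∈ X₁ and s, s' ∈ S with x = x₁·s, x' = x₁'·s' and s·s'⁻¹ ∈ S₁. Then: (i) R is an equivalence relation on X; (ii) R is compatible with the action, i.e. x R x' implies (x·t) R (x'·t) for every t ∈ S; (iii) x R 0_X if and only if x ∈ X₁; (iv) R is the least equivalence relation on X compatible with the action which identifies all points of X₁ with each other. -/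
/-- The operator subgroup (as a set) of a subset `A` in an action: the operators
stabilising `A`. -/
def opSet {X S : Type*} [Group S] (act : X → S → X) (A : Set X) : Set S :=
  {s : S | ∀ a ∈ A, act a s ∈ A}

/-- `A` is a normal subset: whenever `s` links two points of `A`, `A·s ⊆ A`. -/
def IsNormalSubset {X S : Type*} [Group S] (act : X → S → X) (A : Set X) : Prop :=
  ∀ s : S, (∃ a ∈ A, ∃ a' ∈ A, act a s = a') → ∀ a ∈ A, act a s ∈ A

/-- The relation `R` associated with a normal subset `A`:
`x R x'` iff `x = x'` or `x = a·s`, `x' = a'·s'` with `a, a' ∈ A` and `s·s'⁻¹` in the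
operator subgroup of `A`. -/
def cong {X S : Type*} [Group S] (act : X → S → X) (A : Set X) (x x' : X) : Prop :=
  x = x' ∨ ∃ a ∈ A, ∃ a' ∈ A, ∃ s s' : S,
    x = act a s ∧ x' = act a' s' ∧ s * s'⁻¹ ∈ opSet act A

/-- for a normal subset `X₁` of an action `(X, S)`, the relation `R = cong`
is an equivalence relation, compatible with the action; `x R 0_X ↔ x ∈ X₁`; and `R` is
the least compatible equivalence relation identifying all points of `X₁`. -/
theorem cong_is_least_compatible_equivalence
    {X S : Type*} [Group S] (x0 : X) (act : X → S → X)
    (hact_one : ∀ x, act x 1 = x)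
    (hact_mul : ∀ x (s t : S), act (act x s) t = act x (s * t))
    (X₁ : Set X) (hX₁0 : x0 ∈ X₁) (hX₁ : IsNormalSubset act X₁) :
    -- (i)
    Equivalence (cong act X₁) ∧
    -- (ii)
    (∀ x x' : X, ∀ t : S, cong act X₁ x x' → cong act X₁ (act x t) (act x' t)) ∧
    -- (iii)
    (∀ x : X, cong act X₁ x x0 ↔ x ∈ X₁) ∧
    -- (iv)
    (∀ Q : X → X → Prop, Equivalence Q →
      (∀ x x' : X, ∀ t : S, Q x x' → Q (act x t) (act x' t)) →
      (∀ a ∈ X₁, ∀ b ∈ X₁, Q a b) →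
      ∀ x x' : X, cong act X₁ x x' → Q x x') := by
  have key : ∀ x x', cong act X₁ x x' ↔
      (x = x' ∨ ∃ a ∈ X₁, ∃ a' ∈ X₁, ∃ s : S, x = act a s ∧ x' = act a' s) := by
    intro x x'
    constructor
    · rintro (h | ⟨a, ha, a', ha', s, s', h1, h2, h3⟩)
      · exact Or.inl h
      · refine Or.inr ⟨_, h3 a ha, a', ha', s', ?_, h2⟩
        rw [hact_mul, inv_mul_cancel_right, h1]
    · rintro (h | ⟨a, ha, a', ha', s, h1, h2⟩)
      · exact Or.inl h
      · refine Or.inr ⟨a, ha, a', ha', s, s, h1, h2, ?_⟩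
        intro b hb
        rw [mul_inv_cancel, hact_one]
        exact hb
  refine ⟨⟨fun x => Or.inl rfl, ?_, ?_⟩, ?_, ?_, ?_⟩
  · intro x y h
    rw [key] at h ⊢
    rcases h with h | ⟨a, ha, a', ha', s, h1, h2⟩
    · exact Or.inl h.symm
    · exact Or.inr ⟨a', ha', a, ha, s, h2, h1⟩
  · intro x y z h h'
    rw [key] at h h' ⊢
    rcases h with rfl | ⟨a, ha, a', ha', s, h1, h2⟩
    · exact h'
    rcases h' with rfl | ⟨b, hb, b', hb', t, h3, h4⟩
    · exact Or.inr ⟨a, ha, a', ha', s, h1, h2⟩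
    have hl : act a' (s * t⁻¹) = b := by
      rw [← hact_mul, ← h2, h3, hact_mul, mul_inv_cancel, hact_one]
    refine Or.inr ⟨_, hX₁ (s * t⁻¹) ⟨a', ha', b, hb, hl⟩ a ha, b', hb', t, ?_, h4⟩
    rw [hact_mul, inv_mul_cancel_right, h1]
  · intro x y t h
    rw [key] at h ⊢
    rcases h with rfl | ⟨a, ha, a', ha', s, rfl, rfl⟩
    · exact Or.inl rfl
    · exact Or.inr ⟨a, ha, a', ha', s * t, hact_mul _ _ _, hact_mul _ _ _⟩
  · intro x
    rw [key]
    constructor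
    · rintro (rfl | ⟨a, ha, a', ha', s, rfl, h2⟩)
      · exact hX₁0
      · exact hX₁ s ⟨a', ha', x0, hX₁0, h2.symm⟩ a ha
    · intro hx
      exact Or.inr ⟨x, hx, x0, hX₁0, 1, (hact_one _).symm, (hact_one _).symm⟩
  · intro Q hQ hc hA x y h
    rw [key] at h
    rcases h with rfl | ⟨a, ha, a', ha', s, rfl, rfl⟩
    · exact hQ.refl _
    · exact hc _ _ _ (hA a ha a' ha')
end

section
/- Let (f,φ) : (X,S) → (Y,T) be a morphism of actions. Let T₁ be the subgroup of T generated by the set {t ∈ T | there exist x, x' ∈ X with f(x)·t = f(x')}, and set Y₁ := {f(x)·t | x ∈ X, t ∈ T₁}. Then: (i) 0_Y ∈ Y₁ and f(X) ⊆ Y₁; (ii) Y₁·t ⊆ Y₁ for every t ∈ T₁; (iii) if y ∈ Y₁, t ∈ T and y·t ∈ Y₁, then t ∈ T₁. In particular Y₁ is a normal subset of (Y,T) with operator subgroup T₁. -/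
/-- For a morphism of actions `(f, φ) : (X, S) → (Y, T)`, let `T₁` be the
subgroup of `T` generated by the operators linking elements of `f(X)`, and
`Y₁ = f(X)·T₁`. Then `0_Y ∈ Y₁`, `f(X) ⊆ Y₁`, `Y₁` is stable under `T₁`, and any
operator carrying a point of `Y₁` into `Y₁` lies in `T₁`; in particular `Y₁` is a
normal subset of `(Y, T)` with operator subgroup `T₁`. -/
theorem action_morphism_normal_image
    {X S Y T : Type*} [Group S] [Group T]
    (x0 : X) (act : X → S → X)
    (hact_one : ∀ x, act x 1 = x)
    (hact_mul : ∀ x (s t : S), act (act x s) t = act x (s * t))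
    (y0 : Y) (actY : Y → T → Y)
    (hactY_one : ∀ y, actY y 1 = y)
    (hactY_mul : ∀ y (t t' : T), actY (actY y t) t' = actY y (t * t'))
    (f : X → Y) (φ : S →* T)
    (hf0 : f x0 = y0)
    (hmor : ∀ x s, f (act x s) = actY (f x) (φ s))
    (T₁ : Subgroup T)
    (hT₁ : T₁ = Subgroup.closure {t : T | ∃ x x' : X, actY (f x) t = f x'})
    (Y₁ : Set Y)
    (hY₁ : Y₁ = {y : Y | ∃ x : X, ∃ t ∈ T₁, y = actY (f x) t}) :
    -- (i)
    (y0 ∈ Y₁) ∧ (∀ x : X, f x ∈ Y₁) ∧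
    -- (ii)
    (∀ y ∈ Y₁, ∀ t ∈ T₁, actY y t ∈ Y₁) ∧
    -- (iii)
    (∀ y ∈ Y₁, ∀ t : T, actY y t ∈ Y₁ → t ∈ T₁) ∧
    -- in particular: `Y₁` is a normal subset with operator subgroup `T₁`
    (∀ t : T, (∃ y ∈ Y₁, ∃ y' ∈ Y₁, actY y t = y') → ∀ y ∈ Y₁, actY y t ∈ Y₁) ∧
    ({t : T | ∀ y ∈ Y₁, actY y t ∈ Y₁} = (T₁ : Set T)) := by
  have hfx : ∀ x : X, f x ∈ Y₁ := by
    intro x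
    rw [hY₁]
    exact ⟨x, 1, T₁.one_mem, (hactY_one _).symm⟩
  have h2 : ∀ y ∈ Y₁, ∀ t ∈ T₁, actY y t ∈ Y₁ := by
    intro y hy t ht
    rw [hY₁] at hy ⊢
    obtain ⟨x, u, hu, rfl⟩ := hy
    exact ⟨x, u * t, T₁.mul_mem hu ht, hactY_mul _ _ _⟩
  have h3 : ∀ y ∈ Y₁, ∀ t : T, actY y t ∈ Y₁ → t ∈ T₁ := by
    intro y hy t hyt
    rw [hY₁] at hy hyt
    obtain ⟨x, u, hu, rfl⟩ := hy
    obtain ⟨x', v, hv, h⟩ := hyt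
    have key : u * t * v⁻¹ ∈ T₁ := by
      rw [hT₁]
      refine Subgroup.subset_closure ⟨x, x', ?_⟩
      rw [← hactY_mul, ← hactY_mul, h, hactY_mul, mul_inv_cancel, hactY_one]
    have h4 := T₁.mul_mem (T₁.mul_mem (T₁.inv_mem hu) key) hv
    have h5 : u⁻¹ * (u * t * v⁻¹) * v = t := by group
    rwa [h5] at h4
  refine ⟨hf0 ▸ hfx x0, hfx, h2, h3, ?_, ?_⟩
  · rintro t ⟨y, hy, y', hy', rfl⟩ z hz
    exact h2 z hz t (h3 y hy t hy')
  · ext t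
    exact ⟨fun h => h3 _ (hfx x0) t (h _ (hfx x0)), fun ht y hy => h2 y hy t ht⟩
end

section
/- Let (X,S) be an action, X₀ ⊆ X a normal subset with operator subgroup S₀ and associated congruence R, and let p : X → X/R be the projection, so that S acts on the right on the pointed set X/R by [x]·s = [x·s]. Let Y₁ be a normal subset of the action (X/R, S), with associated congruence R' on X/R, and set X₁ := p⁻¹(Y₁). Then X₁ is a normal subset of (X,S) and, denoting by R'' the congruence on X associated with X₁, one has for all x, x' ∈ X: x R'' x' if and only if p(x) R' p(x'). -/
/-- Let `X₀` be a normal subset of `(X, S)` with associated congruence `R`,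
`p : X → X/R` the projection and `actQ` the induced action of `S` on `X/R`. If `Y₁` is a
normal subset of `(X/R, S)` with associated congruence `R'`, then `X₁ := p⁻¹(Y₁)` is a
normal subset of `(X, S)` whose associated congruence `R''` satisfies
`x R'' x' ↔ p(x) R' p(x')`. -/
theorem preimage_normal_subset_congruence
    {X S : Type*} [Group S] (x0 : X) (act : X → S → X)
    (hact_one : ∀ x, act x 1 = x)
    (hact_mul : ∀ x (s t : S), act (act x s) t = act x (s * t))
    (X₀ : Set X) (hX₀0 : x0 ∈ X₀) (hX₀norm : IsNormalSubset act X₀)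
    (hEq : Equivalence (cong act X₀))
    (actQ : Quotient (Setoid.mk (cong act X₀) hEq) → S →
      Quotient (Setoid.mk (cong act X₀) hEq))
    (hactQ : ∀ (x : X) (s : S),
      actQ (Quotient.mk (Setoid.mk (cong act X₀) hEq) x) s
        = Quotient.mk (Setoid.mk (cong act X₀) hEq) (act x s))
    (Y₁ : Set (Quotient (Setoid.mk (cong act X₀) hEq)))
    (hY₁0 : Quotient.mk (Setoid.mk (cong act X₀) hEq) x0 ∈ Y₁)
    (hY₁norm : IsNormalSubset actQ Y₁)
    (X₁ : Set X) (hX₁ : X₁ = Quotient.mk (Setoid.mk (cong act X₀) hEq) ⁻¹' Y₁) :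
    x0 ∈ X₁ ∧
    IsNormalSubset act X₁ ∧
    (∀ x x' : X, cong act X₁ x x' ↔
      cong actQ Y₁ (Quotient.mk (Setoid.mk (cong act X₀) hEq) x)
        (Quotient.mk (Setoid.mk (cong act X₀) hEq) x')) := by
  subst hX₁
  have hn : IsNormalSubset act (Quotient.mk (Setoid.mk (cong act X₀) hEq) ⁻¹' Y₁) := by
    rintro s ⟨a, ha, a', ha', h⟩ b hb
    have := hY₁norm s ⟨_, ha, _, ha', by rw [hactQ, h]⟩ _ hb
    rw [hactQ] at this
    exact this
  have hsub : ∀ a ∈ X₀, Quotient.mk (Setoid.mk (cong act X₀) hEq) a ∈ Y₁ := by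
    intro a ha
    have h : Quotient.mk (Setoid.mk (cong act X₀) hEq) a
        = Quotient.mk (Setoid.mk (cong act X₀) hEq) x0 := by
      apply Quotient.sound
      refine Or.inr ⟨a, ha, x0, hX₀0, 1, 1, (hact_one _).symm, (hact_one _).symm, ?_⟩
      intro b hb
      simpa [hact_one] using hb
    rw [h]
    exact hY₁0
  refine ⟨hY₁0, hn, fun x x' => ⟨?_, ?_⟩⟩
  · rintro (h | ⟨a, ha, a', ha', s, s', h, h', hs⟩)
    · exact Or.inl (by rw [h])
    · refine Or.inr ⟨_, ha, _, ha', s, s', by rw [hactQ, h], by rw [hactQ, h'], ?_⟩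
      intro y hy
      induction y using Quotient.inductionOn with
      | h b =>
        rw [hactQ]
        exact hs b hy
  · rintro (h | ⟨y, hy, y', hy', s, s', h, h', hs⟩)
    · rcases Quotient.exact h with h | ⟨a, ha, a', ha', s, s', h, h', hs⟩
      · exact Or.inl h
      · exact Or.inr ⟨a, hsub a ha, a', hsub a' ha', s, s', h, h',
          hn _ ⟨x0, hY₁0, _, hsub _ (hs x0 hX₀0), rfl⟩⟩
    · have key : ∀ (z : X) (y : Quotient (Setoid.mk (cong act X₀) hEq)) (s : S), y ∈ Y₁ →
          Quotient.mk (Setoid.mk (cong act X₀) hEq) z = actQ y s →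
          Quotient.mk (Setoid.mk (cong act X₀) hEq) (act z s⁻¹) ∈ Y₁ := by
        intro z y s hy h
        rw [← hactQ, h]
        induction y using Quotient.inductionOn with
        | h b =>
          rw [hactQ, hactQ, hact_mul, mul_inv_cancel, hact_one]
          exact hy
      refine Or.inr ⟨_, key x y s hy h, _, key x' y' s' hy' h', s, s', ?_, ?_, ?_⟩
      · rw [hact_mul, inv_mul_cancel, hact_one]
      · rw [hact_mul, inv_mul_cancel, hact_one]
      · intro b hb
        have := hs _ hb
        rw [hactQ] at this
        exact this
end

section
/- Let (X,S) be an action, X₁ ⊆ X a normal subset with operator subgroup S₁, and X₂ ⊆ X₁ a normal subset of the restricted action (X₁,S₁). Let R₂ be the congruence on X associated with X₂ regarded as a normal subset of (X,S), and let R̄₂ be the congruence on X₁ associated with X₂ in the action (X₁,S₁). Then for all x, x' ∈ X₁: x R₂ x' if and only if x R̄₂ x'. Consequently the induced map X₁/R̄₂ → X/R₂ is injective, with image equal to the image of X₁ under the projection X → X/R₂. -/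
/-- Let `X₁` be a normal subset of `(X, S)` with operator (sub)group `H₁`,
`act₁` the restricted action of `H₁` on `X₁`, and `X₂ ⊆ X₁` a normal subset of
`(X₁, H₁)`. Then the congruence `R₂` on `X` associated with `X₂` and the congruence
`R̄₂` on `X₁` associated with `X₂` in `(X₁, H₁)` agree on `X₁`; consequently the induced
map `X₁/R̄₂ → X/R₂` is injective, with range the image of `X₁` in `X/R₂`. -/
theorem subaction_congruence_agrees
    {X S : Type*} [Group S] (x0 : X) (act : X → S → X)
    (hact_one : ∀ x, act x 1 = x)
    (hact_mul : ∀ x (s t : S), act (act x s) t = act x (s * t))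
    (X₁ : Set X) (hX₁0 : x0 ∈ X₁) (hX₁norm : IsNormalSubset act X₁)
    (H₁ : Subgroup S) (hH₁ : (H₁ : Set S) = opSet act X₁)
    (act₁ : X₁ → H₁ → X₁)
    (hact₁ : ∀ (a : X₁) (s : H₁), (act₁ a s : X) = act (a : X) (s : S))
    (X₂ : Set X) (hX₂0 : x0 ∈ X₂) (hX₂sub : X₂ ⊆ X₁)
    (hX₂norm : IsNormalSubset act₁ {a : X₁ | (a : X) ∈ X₂})
    (hE : Equivalence (cong act X₂))
    (hE' : Equivalence (cong act₁ {a : X₁ | (a : X) ∈ X₂}))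
    (F : Quotient (Setoid.mk (cong act₁ {a : X₁ | (a : X) ∈ X₂}) hE') →
      Quotient (Setoid.mk (cong act X₂) hE))
    (hF : ∀ a : X₁,
      F (Quotient.mk (Setoid.mk (cong act₁ {a : X₁ | (a : X) ∈ X₂}) hE') a)
        = Quotient.mk (Setoid.mk (cong act X₂) hE) (a : X)) :
    -- the two congruences agree on `X₁`
    (∀ a b : X₁, cong act X₂ (a : X) (b : X) ↔
      cong act₁ {a : X₁ | (a : X) ∈ X₂} a b) ∧
    -- consequently the induced map is injective ...
    Function.Injective F ∧
    -- ... with image the image of `X₁` under the projection `X → X/R₂`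
    Set.range F = (fun x : X => Quotient.mk (Setoid.mk (cong act X₂) hE) x) '' X₁ := by
  have key : ∀ a b : X₁, cong act X₂ (a : X) (b : X) ↔
      cong act₁ {a : X₁ | (a : X) ∈ X₂} a b := by
    have memH : ∀ s : S, ∀ a ∈ X₂, act a s ∈ X₁ → s ∈ H₁ := by
      intro s a ha h
      have : s ∈ (H₁ : Set S) := by
        rw [hH₁]
        exact hX₁norm s ⟨a, hX₂sub ha, _, h, rfl⟩
      exact this
    intro a b
    constructor
    · rintro (h | ⟨c, hc, c', hc', s, s', h1, h2, h3⟩)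
      · exact Or.inl (Subtype.ext h)
      · have hs : s ∈ H₁ := memH s c hc (h1 ▸ a.2)
        have hs' : s' ∈ H₁ := memH s' c' hc' (h2 ▸ b.2)
        refine Or.inr ⟨⟨c, hX₂sub hc⟩, hc, ⟨c', hX₂sub hc'⟩, hc', ⟨s, hs⟩, ⟨s', hs'⟩, ?_, ?_, ?_⟩
        · apply Subtype.ext
          rw [hact₁]
          exact h1
        · apply Subtype.ext
          rw [hact₁]
          exact h2
        · intro d hd
          change ((act₁ d _ : X₁) : X) ∈ X₂
          rw [hact₁]
          exact h3 d hd
    · rintro (h | ⟨c, hc, c', hc', s, s', h1, h2, h3⟩)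
      · exact Or.inl (congrArg _ h)
      · refine Or.inr ⟨c, hc, c', hc', s, s', ?_, ?_, ?_⟩
        · rw [h1, hact₁]
        · rw [h2, hact₁]
        · intro d hd
          have h4 : ((act₁ ⟨d, hX₂sub hd⟩ (s * s'⁻¹) : X₁) : X) ∈ X₂ := h3 ⟨d, hX₂sub hd⟩ hd
          rw [hact₁] at h4
          exact h4
  refine ⟨key, ?_, ?_⟩
  · intro p q
    induction p using Quotient.inductionOn with | _ a => ?_
    induction q using Quotient.inductionOn with | _ b => ?_
    intro h
    rw [hF, hF] at h
    exact Quotient.sound ((key a b).1 (Quotient.exact h))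
  · ext y
    constructor
    · rintro ⟨p, rfl⟩
      induction p using Quotient.inductionOn with | _ a => ?_
      exact ⟨a, a.2, (hF a).symm⟩
    · rintro ⟨x, hx, rfl⟩
      exact ⟨_, hF ⟨x, hx⟩⟩
end

section
/- Let S and T be groups, S₀ ≤ S and T₀ ≤ T subgroups, and f : S → T a function. The following conditions are equivalent: (a) for every finite list s₁,…,sₙ ∈ S and signs ε₁,…,εₙ ∈ {1,−1}, s₁^{ε₁}·…·sₙ^{εₙ} ∈ S₀ implies f(s₁)^{ε₁}·…·f(sₙ)^{εₙ} ∈ T₀; (c) f(S₀) ⊆ T₀ and f(s₁^{ε₁}·…·sₙ^{εₙ})·(f(s₁)^{ε₁}·…·f(sₙ)^{εₙ})⁻¹ ∈ T₀ for every such list; (c') f(S₀) ⊆ T₀ and (f(s₁^{ε₁}·…·sₙ^{εₙ}))⁻¹·f(s₁)^{ε₁}·…·f(sₙ)^{εₙ} ∈ T₀ for every such list; (d) f(S₀) ⊆ T₀ and f(s·s'^{ε})·f(s')^{−ε}·f(s)⁻¹ ∈ T₀ for all s, s' ∈ S and ε ∈ {1,−1}; (d') f(S₀) ⊆ T₀ and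 (f(s^{ε}·s'))⁻¹·f(s)^{ε}·f(s') ∈ T₀ for all s, s' ∈ S and ε ∈ {1,−1}. -/
/-- The signed combination `s₁^{ε₁}·…·sₙ^{εₙ}` of a list of pairs `(sᵢ, εᵢ)`
(the empty product is `1`). -/
def signedProd {G : Type*} [Group G] (l : List (G × ℤ)) : G :=
  (l.map fun p => p.1 ^ p.2).prod

/-- equivalent characterisations (a), (c), (c'), (d), (d') of
quasi-homomorphisms of pairs `(S, S₀) → (T, T₀)`. -/
theorem quasiHomomorphism_characterisations
    {S T : Type*} [Group S] [Group T] (S₀ : Subgroup S) (T₀ : Subgroup T) (f : S → T) :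
    -- (a) ↔ (c)
    ((∀ l : List (S × ℤ), (∀ p ∈ l, p.2 = 1 ∨ p.2 = -1) →
        signedProd l ∈ S₀ → signedProd (l.map fun p => (f p.1, p.2)) ∈ T₀) ↔
      ((∀ s ∈ S₀, f s ∈ T₀) ∧
        ∀ l : List (S × ℤ), (∀ p ∈ l, p.2 = 1 ∨ p.2 = -1) →
          f (signedProd l) * (signedProd (l.map fun p => (f p.1, p.2)))⁻¹ ∈ T₀)) ∧
    -- (a) ↔ (c')
    ((∀ l : List (S × ℤ), (∀ p ∈ l, p.2 = 1 ∨ p.2 = -1) →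
        signedProd l ∈ S₀ → signedProd (l.map fun p => (f p.1, p.2)) ∈ T₀) ↔
      ((∀ s ∈ S₀, f s ∈ T₀) ∧
        ∀ l : List (S × ℤ), (∀ p ∈ l, p.2 = 1 ∨ p.2 = -1) →
          (f (signedProd l))⁻¹ * signedProd (l.map fun p => (f p.1, p.2)) ∈ T₀)) ∧
    -- (a) ↔ (d)
    ((∀ l : List (S × ℤ), (∀ p ∈ l, p.2 = 1 ∨ p.2 = -1) →
        signedProd l ∈ S₀ → signedProd (l.map fun p => (f p.1, p.2)) ∈ T₀) ↔
      ((∀ s ∈ S₀, f s ∈ T₀) ∧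
        ∀ (s s' : S) (ε : ℤ), (ε = 1 ∨ ε = -1) →
          f (s * s' ^ ε) * (f s') ^ (-ε) * (f s)⁻¹ ∈ T₀)) ∧
    -- (a) ↔ (d')
    ((∀ l : List (S × ℤ), (∀ p ∈ l, p.2 = 1 ∨ p.2 = -1) →
        signedProd l ∈ S₀ → signedProd (l.map fun p => (f p.1, p.2)) ∈ T₀) ↔
      ((∀ s ∈ S₀, f s ∈ T₀) ∧
        ∀ (s s' : S) (ε : ℤ), (ε = 1 ∨ ε = -1) →
          (f (s ^ ε * s'))⁻¹ * (f s) ^ ε * f s' ∈ T₀)) := by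
  have cS : ∀ (p : S × ℤ) l, signedProd (p :: l) = p.1 ^ p.2 * signedProd l := by
    intro p l; simp [signedProd]
  have cT : ∀ (p : T × ℤ) l, signedProd (p :: l) = p.1 ^ p.2 * signedProd l := by
    intro p l; simp [signedProd]
  have aS : ∀ (l m : List (S × ℤ)), signedProd (l ++ m) = signedProd l * signedProd m := by
    intro l m; simp [signedProd]
  have aT : ∀ (l m : List (T × ℤ)), signedProd (l ++ m) = signedProd l * signedProd m := by
    intro l m; simp [signedProd]
  have nS : signedProd ([] : List (S × ℤ)) = 1 := by simp [signedProd]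
  have nT : signedProd ([] : List (T × ℤ)) = 1 := by simp [signedProd]
  have A0 : (∀ l : List (S × ℤ), (∀ p ∈ l, p.2 = 1 ∨ p.2 = -1) →
        signedProd l ∈ S₀ → signedProd (l.map fun p => (f p.1, p.2)) ∈ T₀) →
      ∀ s ∈ S₀, f s ∈ T₀ := by
    intro h s hs
    have := h [(s, 1)] (by simp) (by simpa [cS, nS] using hs)
    simpa [cT, nT] using this
  have C : ((∀ s ∈ S₀, f s ∈ T₀) ∧
        ∀ l : List (S × ℤ), (∀ p ∈ l, p.2 = 1 ∨ p.2 = -1) →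
          f (signedProd l) * (signedProd (l.map fun p => (f p.1, p.2)))⁻¹ ∈ T₀) →
      (∀ l : List (S × ℤ), (∀ p ∈ l, p.2 = 1 ∨ p.2 = -1) →
        signedProd l ∈ S₀ → signedProd (l.map fun p => (f p.1, p.2)) ∈ T₀) := by
    rintro ⟨h0, h⟩ l hl hm
    exact T₀.inv_mem_iff.1 ((T₀.mul_mem_cancel_left (h0 _ hm)).1 (h l hl))
  have C' : ((∀ s ∈ S₀, f s ∈ T₀) ∧
        ∀ l : List (S × ℤ), (∀ p ∈ l, p.2 = 1 ∨ p.2 = -1) →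
          (f (signedProd l))⁻¹ * signedProd (l.map fun p => (f p.1, p.2)) ∈ T₀) →
      (∀ l : List (S × ℤ), (∀ p ∈ l, p.2 = 1 ∨ p.2 = -1) →
        signedProd l ∈ S₀ → signedProd (l.map fun p => (f p.1, p.2)) ∈ T₀) := by
    rintro ⟨h0, h⟩ l hl hm
    exact (T₀.mul_mem_cancel_left (T₀.inv_mem (h0 _ hm))).1 (h l hl)
  refine ⟨⟨fun h => ⟨A0 h, ?_⟩, C⟩, ⟨fun h => ⟨A0 h, ?_⟩, C'⟩,
    ⟨fun h => ⟨A0 h, ?_⟩, fun h => C ⟨h.1, ?_⟩⟩, ⟨fun h => ⟨A0 h, ?_⟩, fun h => C' ⟨h.1, ?_⟩⟩⟩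
  · intro l hl
    have := h (l ++ [(signedProd l, -1)])
      (by
        intro p hp
        rcases List.mem_append.1 hp with hp | hp
        · exact hl p hp
        · right; rw [List.mem_singleton.1 hp])
      (by simp [aS, cS, nS])
    rw [← T₀.inv_mem_iff]
    simpa [aT, cT, nT] using this
  · intro l hl
    have := h ((signedProd l, -1) :: l)
      (by
        intro p hp
        rcases List.mem_cons.1 hp with hp | hp
        · right; rw [hp]
        · exact hl p hp)
      (by simp [cS])
    simpa [cT] using this
  · intro s s' ε hε
    have := h [(s * s' ^ ε, 1), (s', -ε), (s, -1)]
      (by rcases hε with rfl | rfl <;> simp) (by simp [cS, nS])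
    simpa [cT, nT, mul_assoc] using this
  · intro l
    induction l using List.reverseRecOn with
    | nil => intro _; simpa [nS, nT] using h.1 1 S₀.one_mem
    | append_singleton l p ih =>
      intro hl
      have h1 := ih (fun q hq => hl q (by simp [hq]))
      have h2 := h.2 (signedProd l) p.1 p.2 (hl p (by simp))
      have := T₀.mul_mem h2 h1
      simpa [aS, aT, cS, cT, nS, nT, mul_assoc] using this
  · intro s s' ε hε
    have := h [(s ^ ε * s', -1), (s, ε), (s', 1)]
      (by rcases hε with rfl | rfl <;> simp) (by simp [cS, nS, mul_assoc])
    simpa [cT, nT, mul_assoc] using this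
  · intro l
    induction l with
    | nil => intro _; simpa [nS, nT] using h.1 1 S₀.one_mem
    | cons p l ih =>
      intro hl
      have h1 := ih (fun q hq => hl q (by simp [hq]))
      have h2 := h.2 p.1 (signedProd l) p.2 (hl p (by simp))
      have := T₀.mul_mem h2 h1
      simpa [cS, cT, mul_assoc] using this
end

section
/- Let S and T be groups, S₀ ≤ S and T₀ ≤ T subgroups, and let f, g : S → T be quasi-homomorphisms of pairs (S,S₀) → (T,T₀). The following are equivalent: (a) f(s)·g(s)⁻¹ ∈ T₀ for every s ∈ S; (b) f(s)⁻¹·g(s) ∈ T₀ for every s ∈ S; (c) (f(s₁)^{ε₁}·…·f(sₙ)^{εₙ})·(g(s₁)^{ε₁}·…·g(sₙ)^{εₙ})⁻¹ ∈ T₀ for every finite list s₁,…,sₙ ∈ S and signs ε₁,…,εₙ ∈ {1,−1}. -/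
/-- `f` is a quasi-homomorphism of pairs `(S, S₀) → (T, T₀)`. -/
def IsQuasiHom {S T : Type*} [Group S] [Group T]
    (S₀ : Subgroup S) (T₀ : Subgroup T) (f : S → T) : Prop :=
  ∀ l : List (S × ℤ), (∀ p ∈ l, p.2 = 1 ∨ p.2 = -1) →
    signedProd l ∈ S₀ → signedProd (l.map fun p => (f p.1, p.2)) ∈ T₀

/-- for quasi-homomorphisms `f, g` of pairs `(S, S₀) → (T, T₀)`, the
conditions (a) `f(s)·g(s)⁻¹ ∈ T₀`, (b) `f(s)⁻¹·g(s) ∈ T₀` and (c) the corresponding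
condition for all signed combinations, are equivalent. -/
theorem quasiHom_equivalence_characterisations
    {S T : Type*} [Group S] [Group T] (S₀ : Subgroup S) (T₀ : Subgroup T)
    (f g : S → T) (hf : IsQuasiHom S₀ T₀ f) (hg : IsQuasiHom S₀ T₀ g) :
    -- (a) ↔ (b)
    ((∀ s : S, f s * (g s)⁻¹ ∈ T₀) ↔ (∀ s : S, (f s)⁻¹ * g s ∈ T₀)) ∧
    -- (a) ↔ (c)
    ((∀ s : S, f s * (g s)⁻¹ ∈ T₀) ↔
      (∀ l : List (S × ℤ), (∀ p ∈ l, p.2 = 1 ∨ p.2 = -1) →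
        signedProd (l.map fun p => (f p.1, p.2))
          * (signedProd (l.map fun p => (g p.1, p.2)))⁻¹ ∈ T₀)) := by
  have inv1 : ∀ h : S → T, IsQuasiHom S₀ T₀ h → ∀ s, h s * h s⁻¹ ∈ T₀ := by
    intro h hh s
    have := hh [(s, 1), (s⁻¹, 1)] (by simp) (by simp [signedProd])
    simpa [signedProd] using this
  have key : ∀ h : S → T, IsQuasiHom S₀ T₀ h → ∀ l : List (S × ℤ),
      (∀ p ∈ l, p.2 = 1 ∨ p.2 = -1) →
      signedProd (l.map fun p => (h p.1, p.2)) * (h (signedProd l))⁻¹ ∈ T₀ := by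
    intro h hh l hl
    have := hh (l ++ [(signedProd l, -1)])
      (by
        intro p hp
        rcases List.mem_append.1 hp with hp | hp
        · exact hl p hp
        · rw [List.mem_singleton.1 hp]; exact Or.inr rfl)
      (by simp [signedProd])
    simpa [signedProd] using this
  refine ⟨⟨fun ha s => ?_, fun hb s => ?_⟩, fun ha l hl => ?_, fun hc s => ?_⟩
  · have h1 := inv1 f hf s⁻¹
    have h2 := inv1 g hg s⁻¹
    rw [inv_inv] at h1 h2
    have := T₀.mul_mem (T₀.mul_mem (T₀.inv_mem h1) (ha s⁻¹)) h2
    convert this using 1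
    group
  · have h1 := inv1 f hf s
    have h2 := inv1 g hg s
    have := T₀.mul_mem (T₀.mul_mem h1 (hb s⁻¹)) (T₀.inv_mem h2)
    convert this using 1
    group
  · have := T₀.mul_mem (T₀.mul_mem (key f hf l hl) (ha (signedProd l)))
      (T₀.inv_mem (key g hg l hl))
    convert this using 1
    group
  · simpa [signedProd] using hc [(s, 1)] (by simp)
end

section
/- Let S and T be groups, S₀ ≤ S and T₀ ≤ T subgroups, and let f, g : S → T be quasi-homomorphisms of pairs (S,S₀) → (T,T₀) such that f(s)·g(s)⁻¹ ∈ T₀ for every s ∈ S. Let U be the subgroup of T generated by f(S) ∪ g(S), and let N be the subgroup of T generated by all elements (f(s₁)^{ε₁}·…·f(sₙ)^{εₙ})·(g(s₁)^{ε₁}·…·g(sₙ)^{εₙ})⁻¹ with s₁,…,sₙ ∈ S and ε₁,…,εₙ ∈ {1,−1}. Then N ⊆ T₀ ∩ U and N is a normal subgroup of U. -/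
/-- for `R`-equivalent quasi-homomorphisms `f, g : (S, S₀) → (T, T₀)`,
the subgroup `N` generated by the differences of signed combinations of `f` and `g` is
contained in `T₀ ∩ U`, where `U = ⟨f(S) ∪ g(S)⟩`, and `N` is normal in `U`. -/
theorem quasiHom_difference_subgroup_normal
    {S T : Type*} [Group S] [Group T] (S₀ : Subgroup S) (T₀ : Subgroup T)
    (f g : S → T) (hf : IsQuasiHom S₀ T₀ f) (hg : IsQuasiHom S₀ T₀ g)
    (hfg : ∀ s : S, f s * (g s)⁻¹ ∈ T₀)
    (U : Subgroup T) (hU : U = Subgroup.closure (Set.range f ∪ Set.range g))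
    (N : Subgroup T)
    (hN : N = Subgroup.closure
      {t : T | ∃ l : List (S × ℤ), (∀ p ∈ l, p.2 = 1 ∨ p.2 = -1) ∧
        t = signedProd (l.map fun p => (f p.1, p.2))
          * (signedProd (l.map fun p => (g p.1, p.2)))⁻¹}) :
    N ≤ T₀ ⊓ U ∧
    (∀ u ∈ U, ∀ n ∈ N, u * n * u⁻¹ ∈ N) := by
  classical
  have key : ∀ l : List (S × ℤ), (∀ p ∈ l, p.2 = 1 ∨ p.2 = -1) →
      signedProd (l.map fun p => (f p.1, p.2))
          * (signedProd (l.map fun p => (g p.1, p.2)))⁻¹ ∈ N := by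
    intro l hl
    rw [hN]
    exact Subgroup.subset_closure ⟨l, hl, rfl⟩
  have sgn : ∀ (s : S) (e : ℤ), (e = 1 ∨ e = -1) → f s ^ e * (g s ^ e)⁻¹ ∈ N := by
    intro s e he
    have h := key [(s, e)] (by simpa using he)
    simpa [signedProd] using h
  have inU : ∀ (h : S → T), (∀ s, h s ∈ U) → ∀ l : List (S × ℤ),
      signedProd (l.map fun p => (h p.1, p.2)) ∈ U := by
    intro h hh l
    unfold signedProd
    apply Subgroup.list_prod_mem
    intro x hx
    simp only [List.map_map, List.mem_map, Function.comp] at hx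
    obtain ⟨p, _, rfl⟩ := hx
    exact U.zpow_mem (hh _) _
  have close : ∀ (h : S → T), IsQuasiHom S₀ T₀ h → ∀ l : List (S × ℤ),
      (∀ p ∈ l, p.2 = 1 ∨ p.2 = -1) →
      signedProd (l.map fun p => (h p.1, p.2)) * (h (signedProd l))⁻¹ ∈ T₀ := by
    intro h hh l hl
    have := hh (l ++ [(signedProd l, -1)]) (by
      intro p hp
      rcases List.mem_append.1 hp with hp | hp
      · exact hl p hp
      · right
        rw [List.mem_singleton.1 hp]) (by
      have : signedProd (l ++ [(signedProd l, -1)]) = 1 := by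
        simp [signedProd]
      rw [this]
      exact S₀.one_mem)
    simpa [signedProd] using this
  have conjf : ∀ (s : S) (e : ℤ), (e = 1 ∨ e = -1) → ∀ n ∈ N,
      f s ^ e * n * (f s ^ e)⁻¹ ∈ N := by
    intro s e he n hn
    rw [hN] at hn
    induction hn using Subgroup.closure_induction with
    | mem x hx =>
      obtain ⟨l, hl, rfl⟩ := hx
      have h1 := key ((s, e) :: l) (by
        intro p hp
        rcases List.mem_cons.1 hp with rfl | hp
        · exact he
        · exact hl p hp)
      have h2 := N.mul_mem h1 (N.inv_mem (sgn s e he))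
      convert h2 using 1
      simp only [signedProd, List.map_cons, List.prod_cons]
      group
    | one => simp
    | mul x y _ _ hx hy =>
      convert N.mul_mem hx hy using 1
      group
    | inv x _ hx =>
      convert N.inv_mem hx using 1
      group
  have conjg : ∀ (s : S) (e : ℤ), (e = 1 ∨ e = -1) → ∀ n ∈ N,
      g s ^ e * n * (g s ^ e)⁻¹ ∈ N := by
    intro s e he n hn
    have h1 := sgn s e he
    convert N.mul_mem (N.mul_mem (N.inv_mem h1) (conjf s e he n hn)) h1 using 1
    group
  refine ⟨?_, ?_⟩
  · rw [hN, Subgroup.closure_le]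
    rintro _ ⟨l, hl, rfl⟩
    refine Subgroup.mem_inf.2 ⟨?_, ?_⟩
    · have h := T₀.mul_mem (T₀.mul_mem (close f hf l hl) (hfg (signedProd l)))
        (T₀.inv_mem (close g hg l hl))
      convert h using 1
      group
    · refine U.mul_mem (inU f ?_ l) (U.inv_mem (inU g ?_ l))
      · intro s
        rw [hU]
        exact Subgroup.subset_closure (Or.inl ⟨s, rfl⟩)
      · intro s
        rw [hU]
        exact Subgroup.subset_closure (Or.inr ⟨s, rfl⟩)
  · intro u hu
    suffices h : (∀ n ∈ N, u * n * u⁻¹ ∈ N) ∧ (∀ n ∈ N, u⁻¹ * n * u ∈ N) from h.1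
    rw [hU] at hu
    induction hu using Subgroup.closure_induction with
    | mem x hx =>
      rcases hx with ⟨s, rfl⟩ | ⟨s, rfl⟩
      · exact ⟨fun n hn => by simpa using conjf s 1 (Or.inl rfl) n hn,
          fun n hn => by simpa using conjf s (-1) (Or.inr rfl) n hn⟩
      · exact ⟨fun n hn => by simpa using conjg s 1 (Or.inl rfl) n hn,
          fun n hn => by simpa using conjg s (-1) (Or.inr rfl) n hn⟩
    | one => simp
    | mul x y _ _ hx hy =>
      refine ⟨fun n hn => ?_, fun n hn => ?_⟩
      · convert hx.1 _ (hy.1 n hn) using 1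
        group
      · convert hy.2 _ (hx.2 n hn) using 1
        group
    | inv x _ hx =>
      exact ⟨fun n hn => by simpa using hx.2 n hn, fun n hn => by simpa using hx.1 n hn⟩
end

section
/- Let X and Y be bounded lattices, and equip X × Y with the componentwise order. Define Galois connections p : X × Y → X with p₁(x,y) = x, p₂(x) = (x,⊤); q : X × Y → Y with q₁(x,y) = y, q₂(y) = (⊤,y); i : X → X × Y with i₁(x) = (x,⊥), i₂(x,y) = x; and j : Y → X × Y with j₁(y) = (⊥,y), j₂(x,y) = y. Then X × Y is a biproduct in the category of bounded lattices and Galois connections: (i) for every bounded lattice Z and Galois connections f : Z → X, g : Z → Y there is a unique Galois connection h : Z → X × Y with p ∘ h = f and q ∘ h = g; (ii) for every bounded lattice Z and Galois connections f : X → Z, g : Y → Z there is a unique Galois connection k : X × Y → Z with k ∘ i = f and k ∘ j = g. -/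
/-- for bounded lattices `X`, `Y`, the product `X × Y` (componentwise
order) with the projections `p, q` and injections `i, j` below is a biproduct in the
category of bounded lattices and Galois connections (a Galois connection is determined
by its lower adjoint; composition composes lower adjoints covariantly). -/
theorem lattice_galoisConnection_biproduct
    {X Y : Type*} [Lattice X] [BoundedOrder X] [Lattice Y] [BoundedOrder Y] :
    -- p, q, i, j are Galois connections
    GaloisConnection (fun xy : X × Y => xy.1) (fun x : X => (x, (⊤ : Y))) ∧
    GaloisConnection (fun xy : X × Y => xy.2) (fun y : Y => ((⊤ : X), y)) ∧
    GaloisConnection (fun x : X => (x, (⊥ : Y))) (fun xy : X × Y => xy.1) ∧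
    GaloisConnection (fun y : Y => ((⊥ : X), y)) (fun xy : X × Y => xy.2) ∧
    -- (i) universal property of the product
    (∀ (Z : Type*) (_ : Lattice Z) (_ : BoundedOrder Z)
      (f₁ : Z → X) (f₂ : X → Z) (g₁ : Z → Y) (g₂ : Y → Z),
      GaloisConnection f₁ f₂ → GaloisConnection g₁ g₂ →
      ∃! h₁ : Z → X × Y, ∃ h₂ : X × Y → Z, GaloisConnection h₁ h₂ ∧
        (∀ z, (h₁ z).1 = f₁ z) ∧ (∀ z, (h₁ z).2 = g₁ z)) ∧
    -- (ii) universal property of the coproduct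
    (∀ (Z : Type*) (_ : Lattice Z) (_ : BoundedOrder Z)
      (f₁ : X → Z) (f₂ : Z → X) (g₁ : Y → Z) (g₂ : Z → Y),
      GaloisConnection f₁ f₂ → GaloisConnection g₁ g₂ →
      ∃! k₁ : X × Y → Z, ∃ k₂ : Z → X × Y, GaloisConnection k₁ k₂ ∧
        (∀ x : X, k₁ (x, ⊥) = f₁ x) ∧ (∀ y : Y, k₁ (⊥, y) = g₁ y)) := by
  refine ⟨?_, ?_, ?_, ?_, ?_, ?_⟩
  · intro a b; simp [Prod.le_def]
  · intro a b; simp [Prod.le_def]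
  · intro a b; simp [Prod.le_def]
  · intro a b; simp [Prod.le_def]
  · intro Z _ _ f₁ f₂ g₁ g₂ hf hg
    refine ⟨fun z => (f₁ z, g₁ z), ⟨fun w => f₂ w.1 ⊓ g₂ w.2, ?_, fun _ => rfl, fun _ => rfl⟩, ?_⟩
    · intro a b
      rw [Prod.le_def, le_inf_iff]
      exact and_congr (hf _ _) (hg _ _)
    · rintro h ⟨_, _, h1, h2⟩
      funext z
      exact Prod.ext (h1 z) (h2 z)
  · intro Z _ _ f₁ f₂ g₁ g₂ hf hg
    refine ⟨fun w => f₁ w.1 ⊔ g₁ w.2, ⟨fun z => (f₂ z, g₂ z), ?_, ?_, ?_⟩, ?_⟩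
    · intro a b
      rw [Prod.le_def, sup_le_iff]
      exact and_congr (hf _ _) (hg _ _)
    · intro x; simp [hg.l_bot]
    · intro y; simp [hf.l_bot]
    · rintro k ⟨_, hk, h1, h2⟩
      funext ⟨x, y⟩
      have h := hk.l_sup (a₁ := (x, (⊥ : Y))) (a₂ := ((⊥ : X), y))
      rw [h1, h2] at h
      simpa using h
end

section
/- Let X and Y be bounded modular lattices and (f₁, f₂) a Galois connection from X to Y. The following are equivalent: (a) f₂(f₁(x)) = x ⊔ f₂(⊥) for every x ∈ X and f₁(f₂(y)) = y ⊓ f₁(⊤) for every y ∈ Y; (b) f₂(f₁(x) ⊔ y) = x ⊔ f₂(y) and f₁(f₂(y) ⊓ x) = y ⊓ f₁(x) for all x ∈ X and y ∈ Y. -/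
/-- for a Galois connection `(f₁, f₂)` between bounded modular lattices,
the exactness conditions (a) `f₂f₁x = x ⊔ f₂⊥` and `f₁f₂y = y ⊓ f₁⊤` are equivalent to
the modular-connection identities (b) `f₂(f₁x ⊔ y) = x ⊔ f₂y` and
`f₁(f₂y ⊓ x) = y ⊓ f₁x`. -/
theorem galoisConnection_exact_iff_modular
    {X Y : Type*} [Lattice X] [BoundedOrder X] [IsModularLattice X]
    [Lattice Y] [BoundedOrder Y] [IsModularLattice Y]
    (f₁ : X → Y) (f₂ : Y → X) (hf : GaloisConnection f₁ f₂) :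
    ((∀ x : X, f₂ (f₁ x) = x ⊔ f₂ ⊥) ∧ (∀ y : Y, f₁ (f₂ y) = y ⊓ f₁ ⊤)) ↔
    ((∀ (x : X) (y : Y), f₂ (f₁ x ⊔ y) = x ⊔ f₂ y) ∧
      (∀ (x : X) (y : Y), f₁ (f₂ y ⊓ x) = y ⊓ f₁ x)) := by
  constructor
  · rintro ⟨ha, hb⟩
    constructor
    · intro x y
      apply le_antisymm
      · have h1 : f₁ (f₂ (f₁ x ⊔ y)) = f₁ (x ⊔ f₂ y) := by
          rw [hb, sup_inf_assoc_of_le y (hf.monotone_l le_top), ← hb, hf.l_sup]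
        have h2 := hf.le_u_l (f₂ (f₁ x ⊔ y))
        rw [h1, ha] at h2
        exact h2.trans (sup_le le_rfl ((hf.monotone_u bot_le).trans le_sup_right))
      · exact sup_le ((hf.le_u_l x).trans (hf.monotone_u le_sup_left))
          (hf.monotone_u le_sup_right)
    · intro x y
      have h1 : f₂ (y ⊓ f₁ x) = f₂ (f₁ (f₂ y ⊓ x)) := by
        have h3 : f₂ ⊥ ≤ f₂ y := hf.monotone_u bot_le
        rw [hf.u_inf, ha, ha, sup_comm x, inf_comm, sup_inf_assoc_of_le x h3, inf_comm x,
          sup_comm]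
      have h2 := hb (y ⊓ f₁ x)
      rw [h1, hf.l_u_l_eq_l] at h2
      rw [h2]
      exact inf_eq_left.2 (inf_le_right.trans (hf.monotone_l le_top))
  · rintro ⟨ha, hb⟩
    constructor
    · intro x
      simpa using ha x ⊥
    · intro y
      simpa using hb ⊤ y
end
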